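/- Let w be a valuation on the fibred matrix M_(λ,μ) and let w₁ be the M₁-valuation determined by w₁(p) = ∗_μ(w(p)) for every propositional variable p. Then for every non-atomic formula φ ∈ L(C₁) (i.e., φ not a variable), w(φ) = w₁(φ). -/

import Mathlib

set_option autoImplicit false

namespace Fibring

/-- Propositional formulas over a signature `C` with arity function `ar`. -/
inductive Fm (C : Type) (ar : C → ℕ) : Type
  | var : ℕ → Fm C ar
  | app : (c : C) → (Fin (ar c) → Fm C ar) → Fm C ar

/-- Homomorphic extension of a valuation `v` to all formulas, relative to an
interpretation `I` of the connectives. -/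
def eval {C A : Type} {ar : C → ℕ}
    (I : (c : C) → (Fin (ar c) → A) → A) (v : ℕ → A) : Fm C ar → A
  | .var n => v n
  | .app c args => I c fun i => eval I v (args i)

/-- Matrix consequence relation. -/
def Mdl {C A : Type} {ar : C → ℕ}
    (I : (c : C) → (Fin (ar c) → A) → A) (D : Set A)
    (Γ : Set (Fm C ar)) (φ : Fm C ar) : Prop :=
  ∀ v : ℕ → A, (∀ ψ ∈ Γ, eval I v ψ ∈ D) → eval I v φ ∈ D

/-- Substitution. -/
def subst {C : Type} {ar : C → ℕ} (σ : ℕ → Fm C ar) : Fm C ar → Fm C ar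
  | .var n => σ n
  | .app c args => .app c fun i => subst σ (args i)

variable {C₁ C₂ A₁ A₂ : Type} {ar₁ : C₁ → ℕ} {ar₂ : C₂ → ℕ}

/-- The coercion `∗_μ : A₁ ⊎ A₂ → A₁`. -/
def starMu (mu : A₂ → A₁) : A₁ ⊕ A₂ → A₁ := Sum.elim id mu

/-- The coercion `∗_λ : A₁ ⊎ A₂ → A₂`. -/
def starLa (lam : A₁ → A₂) : A₁ ⊕ A₂ → A₂ := Sum.elim lam id

/-- Interpretation of the fibred matrix `M_(λ,μ)`. -/
def fibInterp (I₁ : (c : C₁) → (Fin (ar₁ c) → A₁) → A₁)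
    (I₂ : (c : C₂) → (Fin (ar₂ c) → A₂) → A₂)
    (lam : A₁ → A₂) (mu : A₂ → A₁) :
    (c : C₁ ⊕ C₂) → (Fin (Sum.elim ar₁ ar₂ c) → A₁ ⊕ A₂) → A₁ ⊕ A₂
  | .inl c, args => Sum.inl (I₁ c fun i => starMu mu (args i))
  | .inr c, args => Sum.inr (I₂ c fun i => starLa lam (args i))

/-- Designated values of the fibred matrix: `D₁ ⊎ D₂`. -/
def Dfib (D₁ : Set A₁) (D₂ : Set A₂) : Set (A₁ ⊕ A₂) :=
  Sum.inl '' D₁ ∪ Sum.inr '' D₂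

/-- Admissible fibring pairs: `λ` and `μ` preserve and reflect designatedness. -/
def Admissible (D₁ : Set A₁) (D₂ : Set A₂) (lam : A₁ → A₂) (mu : A₂ → A₁) : Prop :=
  (∀ x, lam x ∈ D₂ ↔ x ∈ D₁) ∧ (∀ y, mu y ∈ D₁ ↔ y ∈ D₂)

/-- Recursive extension of a simple fibred valuation to the fibred language. -/
def sfvExt (I₁ : (c : C₁) → (Fin (ar₁ c) → A₁) → A₁)
    (I₂ : (c : C₂) → (Fin (ar₂ c) → A₂) → A₂)
    (lam : A₁ → A₂) (mu : A₂ → A₁) (v : ℕ → A₁ ⊕ A₂) :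
    Fm (C₁ ⊕ C₂) (Sum.elim ar₁ ar₂) → A₁ ⊕ A₂
  | .var n => v n
  | .app (.inl c) args =>
      Sum.inl (I₁ c fun i => starMu mu (sfvExt I₁ I₂ lam mu v (args i)))
  | .app (.inr c) args =>
      Sum.inr (I₂ c fun i => starLa lam (sfvExt I₁ I₂ lam mu v (args i)))

/-- Inclusion of `L(C₁)` into the fibred language `L(C₁ ⊎ C₂)`. -/
def inj₁ (ar₂ : C₂ → ℕ) : Fm C₁ ar₁ → Fm (C₁ ⊕ C₂) (Sum.elim ar₁ ar₂)
  | .var n => .var n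
  | .app c args => .app (Sum.inl c) fun i => inj₁ ar₂ (args i)

/-- `Repl c₁ c₂ h φ ψ`: `ψ` results from `φ` by replacing exactly one occurrence
of `c₁` by `c₂`. -/
inductive Repl {C : Type} {ar : C → ℕ} (c₁ c₂ : C) (h : ar c₁ = ar c₂) :
    Fm C ar → Fm C ar → Prop
  | top (args : Fin (ar c₁) → Fm C ar) :
      Repl c₁ c₂ h (.app c₁ args) (.app c₂ fun i => args (Fin.cast h.symm i))
  | congr (c : C) (args args' : Fin (ar c) → Fm C ar) (j : Fin (ar c))
      (hj : Repl c₁ c₂ h (args j) (args' j))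
      (hother : ∀ i, i ≠ j → args i = args' i) :
      Repl c₁ c₂ h (.app c args) (.app c args')

/-- `(c₁,c₂)`-associated formulas: a finite chain of single replacements of
`c₁` by `c₂` or vice versa (including equality). -/
def Assoc {C : Type} {ar : C → ℕ} (c₁ c₂ : C) (h : ar c₁ = ar c₂)
    (φ₁ φ₂ : Fm C ar) : Prop :=
  Relation.EqvGen (Repl c₁ c₂ h) φ₁ φ₂


theorem starMu_eval_inj
    {C₁ C₂ A₁ A₂ : Type} {ar₁ : C₁ → ℕ} {ar₂ : C₂ → ℕ}
    (I₁ : (c : C₁) → (Fin (ar₁ c) → A₁) → A₁)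
    (I₂ : (c : C₂) → (Fin (ar₂ c) → A₂) → A₂)
    (lam : A₁ → A₂) (mu : A₂ → A₁)
    (w : ℕ → A₁ ⊕ A₂) (φ : Fm C₁ ar₁) :
    starMu mu (eval (fibInterp I₁ I₂ lam mu) w (inj₁ ar₂ φ)) =
      eval I₁ (fun n => starMu mu (w n)) φ := by
  induction φ with
  | var n => rfl
  | app c args ih => exact congrArg (I₁ c) (funext ih)

/-- Lemma 1: for a fibred valuation `w` and the `M₁`-valuation
`w₁ p = ∗_μ(w p)`, every non-atomic formula of `L(C₁)` gets the same value
under `w` (in the fibred matrix) and under `w₁` (in `M₁`). -/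
theorem fibred_valuation_restricts
    {C₁ C₂ A₁ A₂ : Type} {ar₁ : C₁ → ℕ} {ar₂ : C₂ → ℕ}
    (I₁ : (c : C₁) → (Fin (ar₁ c) → A₁) → A₁)
    (I₂ : (c : C₂) → (Fin (ar₂ c) → A₂) → A₂)
    (lam : A₁ → A₂) (mu : A₂ → A₁)
    (w : ℕ → A₁ ⊕ A₂) (φ : Fm C₁ ar₁) (hφ : ∀ n, φ ≠ .var n) :
    eval (fibInterp I₁ I₂ lam mu) w (inj₁ ar₂ φ) =
      Sum.inl (eval I₁ (fun n => starMu mu (w n)) φ) := by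
  cases φ with
  | var n => exact absurd rfl (hφ n)
  | app c args =>
    exact congrArg (fun a => Sum.inl (I₁ c a))
      (funext fun i => starMu_eval_inj I₁ I₂ lam mu w (args i))

end Fibring
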